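/- arXiv:1707.09542 — 3 statements merged into one kernel-verified Lean document; each statement's English description precedes it below -/
import Mathlib

section
/- Let K be a field, N ≥ 1 an integer, and h ∈ K. For all u, v ∈ K with u ≠ 0, v ≠ 0 and u + v ≠ 0, the Yang R-matrix satisfies the Yang–Baxter equation on K^N ⊗ K^N ⊗ K^N: R₁₂(u) · R₁₃(u+v) · R₂₃(v) = R₂₃(v) · R₁₃(u+v) · R₁₂(u). -/
/-- The permutation operator `P` on `K^N ⊗ K^N`, `P(x ⊗ y) = y ⊗ x`,
written as a matrix with rows/columns indexed by `Fin N × Fin N`. -/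
def permP (K : Type*) [Field K] (N : ℕ) : Matrix (Fin N × Fin N) (Fin N × Fin N) K :=
  fun p q => if p.1 = q.2 ∧ p.2 = q.1 then 1 else 0

/-- The Yang R-matrix `R(z) = id - (h/z) • P` on `K^N ⊗ K^N`. -/
def yangR (K : Type*) [Field K] (N : ℕ) (h z : K) :
    Matrix (Fin N × Fin N) (Fin N × Fin N) K :=
  1 - (h / z) • permP K N

/-- The operator on `(K^N)^{⊗ n}` acting as a given two-site operator `A` on the
tensor factors `p` and `q` (with `p ≠ q`) and as the identity elsewhere. -/
def lift2 (K : Type*) [Field K] (N n : ℕ) (p q : Fin n)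
    (A : Matrix (Fin N × Fin N) (Fin N × Fin N) K) :
    Matrix (Fin n → Fin N) (Fin n → Fin N) K :=
  fun x y => A (x p, x q) (y p, y q) *
    ∏ k ∈ Finset.univ.filter (fun k => k ≠ p ∧ k ≠ q), (if x k = y k then (1 : K) else 0)

/-- The permutation of the tensor factors of `V^{⊗ ι}` (with `V` having basis `α`) by `σ`. -/
def sitePerm (K : Type*) [Field K] {ι α : Type*} [Fintype ι] [DecidableEq α]
    (σ : Equiv.Perm ι) : Matrix (ι → α) (ι → α) K :=
  fun x y => if x ∘ σ = y then 1 else 0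

theorem sitePerm_mul (K : Type*) [Field K] {ι α : Type*} [Fintype ι] [DecidableEq ι]
    [Fintype α] [DecidableEq α] (σ τ : Equiv.Perm ι) :
    (sitePerm K σ * sitePerm K τ : Matrix (ι → α) (ι → α) K) = sitePerm K (σ * τ) := by
  ext x y
  simp only [Matrix.mul_apply, sitePerm, ite_mul, one_mul, zero_mul, Finset.sum_ite_eq,
    Finset.mem_univ, if_true]
  rfl

theorem lift2_one (K : Type*) [Field K] (N n : ℕ) (p q : Fin n) : lift2 K N n p q 1 = 1 := by
  ext x y
  simp only [lift2, Matrix.one_apply, Finset.prod_ite_zero, Finset.prod_const_one,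
    Finset.mem_filter, Finset.mem_univ, true_and, ← ite_and, mul_ite, mul_one, mul_zero,
    Prod.mk.injEq]
  refine if_congr ⟨fun hxy => ?_, ?_⟩ rfl rfl
  · funext k
    grind
  · rintro rfl
    simp

theorem lift2_permP (K : Type*) [Field K] (N n : ℕ) {p q : Fin n} (hpq : p ≠ q) :
    lift2 K N n p q (permP K N) = sitePerm K (Equiv.swap p q) := by
  ext x y
  simp only [lift2, permP, sitePerm, Finset.prod_ite_zero, Finset.prod_const_one,
    Finset.mem_filter, Finset.mem_univ, true_and, ← ite_and, mul_ite, mul_one, mul_zero]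
  refine if_congr ⟨fun hxy => ?_, ?_⟩ rfl rfl
  · funext k
    simp only [Function.comp_apply, Equiv.swap_apply_def]
    grind
  · rintro rfl
    simp only [Function.comp_apply, Equiv.swap_apply_def]
    grind

theorem lift2_yangR (K : Type*) [Field K] (N n : ℕ) {p q : Fin n} (hpq : p ≠ q) (h z : K) :
    lift2 K N n p q (yangR K N h z) = 1 - (h / z) • sitePerm K (Equiv.swap p q) := by
  rw [← lift2_permP K N n hpq, ← lift2_one K N n p q]
  ext x y
  simp only [lift2, yangR, Matrix.sub_apply, Matrix.smul_apply, smul_eq_mul]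
  ring

/-- The Yang R-matrix satisfies the Yang–Baxter equation
`R₁₂(u) R₁₃(u+v) R₂₃(v) = R₂₃(v) R₁₃(u+v) R₁₂(u)` on `K^N ⊗ K^N ⊗ K^N`. -/
theorem yangR_yang_baxter (K : Type*) [Field K] (N : ℕ) (hN : 1 ≤ N) (h : K)
    (u v : K) (hu : u ≠ 0) (hv : v ≠ 0) (huv : u + v ≠ 0) :
    lift2 K N 3 0 1 (yangR K N h u) * lift2 K N 3 0 2 (yangR K N h (u + v)) *
        lift2 K N 3 1 2 (yangR K N h v) =
      lift2 K N 3 1 2 (yangR K N h v) * lift2 K N 3 0 2 (yangR K N h (u + v)) *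
        lift2 K N 3 0 1 (yangR K N h u) := by
  have hcoef : h / u * (h / (u + v)) + h / (u + v) * (h / v) = h / u * (h / v) := by
    field_simp
    ring
  rw [lift2_yangR K N 3 (by decide), lift2_yangR K N 3 (by decide),
    lift2_yangR K N 3 (by decide)]
  generalize h / u = a at *
  generalize h / (u + v) = b at *
  generalize h / v = c at *
  simp only [sub_mul, mul_sub, one_mul, mul_one, smul_mul_assoc, mul_smul_comm, sitePerm_mul]
  have e₁ : (Equiv.swap 0 2 * Equiv.swap 1 2 : Equiv.Perm (Fin 3)) =
      Equiv.swap 0 1 * Equiv.swap 0 2 := by decide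
  have e₂ : (Equiv.swap 1 2 * Equiv.swap 0 1 : Equiv.Perm (Fin 3)) =
      Equiv.swap 0 1 * Equiv.swap 0 2 := by decide
  have e₃ : (Equiv.swap 1 2 * Equiv.swap 0 2 : Equiv.Perm (Fin 3)) =
      Equiv.swap 0 1 * Equiv.swap 1 2 := by decide
  have e₄ : (Equiv.swap 0 2 * Equiv.swap 0 1 : Equiv.Perm (Fin 3)) =
      Equiv.swap 0 1 * Equiv.swap 1 2 := by decide
  have e₅ : (Equiv.swap 0 1 * Equiv.swap 0 2 * Equiv.swap 1 2 : Equiv.Perm (Fin 3)) =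
      Equiv.swap 0 2 := by decide
  have e₆ : (Equiv.swap 0 1 * Equiv.swap 1 2 * Equiv.swap 0 1 : Equiv.Perm (Fin 3)) =
      Equiv.swap 0 2 := by decide
  simp only [e₁, e₂, e₃, e₄, e₅, e₆]
  linear_combination (norm := module) hcoef • (sitePerm K (Equiv.swap 0 1 * Equiv.swap 0 2) -
    sitePerm K (Equiv.swap 0 1 * Equiv.swap 1 2) : Matrix (Fin 3 → Fin N) (Fin 3 → Fin N) K)
end

section
/- Let K be a field, N ≥ 1 an integer, and h ∈ K. For every u ∈ K with u ≠ 0, u² ≠ h² and u + hN ≠ 0, the Yang R-matrix satisfies the (unnormalized) crossing symmetry relation in the first tensor factor: (R(u)⁻¹)^{t₁} · (R(u + hN))^{t₁} = (1 − h²u⁻²)⁻¹ · id on K^N ⊗ K^N. -/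
/-- The partial transpose `t₁` on `End(K^N) ⊗ End(K^N)`, determined by
`(A ⊗ B)^{t₁} = Aᵀ ⊗ B`. -/
def pt1 {K : Type*} [Field K] {N : ℕ}
    (M : Matrix (Fin N × Fin N) (Fin N × Fin N) K) :
    Matrix (Fin N × Fin N) (Fin N × Fin N) K :=
  fun p q => M (q.1, p.2) (p.1, q.2)

theorem permP_mul_permP (K : Type*) [Field K] (N : ℕ) : permP K N * permP K N = 1 := by
  ext ⟨a, b⟩ ⟨c, d⟩
  rw [Matrix.mul_apply, Finset.sum_eq_single (b, a)]
  · simp [permP, Matrix.one_apply, and_comm]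
  · rintro ⟨e, f⟩ - hne
    have : ¬(a = f ∧ b = e) := fun hab => hne (by simp [hab.1, hab.2])
    simp [permP, this]
  · simp

/-- The inverse `R(z)⁻¹ = (1 - h²/z²)⁻¹ (1 + (h/z) P)`. -/
theorem yangR_inv (K : Type*) [Field K] (N : ℕ) {h z : K} (hz : 1 - h ^ 2 / z ^ 2 ≠ 0) :
    (yangR K N h z)⁻¹ = (1 - h ^ 2 / z ^ 2)⁻¹ • (1 + (h / z) • permP K N) := by
  apply Matrix.inv_eq_right_inv
  have key : yangR K N h z * (1 + (h / z) • permP K N) =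
      (1 - h ^ 2 / z ^ 2) • (1 : Matrix (Fin N × Fin N) (Fin N × Fin N) K) := by
    simp only [yangR, sub_mul, mul_add, one_mul, mul_one, smul_mul_smul_comm, permP_mul_permP]
    rw [← div_pow]
    module
  rw [mul_smul_comm, key, smul_smul, inv_mul_cancel₀ hz, one_smul]

theorem pt1_add {K : Type*} [Field K] {N : ℕ} (A B : Matrix (Fin N × Fin N) (Fin N × Fin N) K) :
    pt1 (A + B) = pt1 A + pt1 B := rfl

theorem pt1_sub {K : Type*} [Field K] {N : ℕ} (A B : Matrix (Fin N × Fin N) (Fin N × Fin N) K) :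
    pt1 (A - B) = pt1 A - pt1 B := rfl

theorem pt1_smul {K : Type*} [Field K] {N : ℕ} (c : K)
    (A : Matrix (Fin N × Fin N) (Fin N × Fin N) K) : pt1 (c • A) = c • pt1 A := rfl

theorem pt1_one (K : Type*) [Field K] (N : ℕ) :
    pt1 (1 : Matrix (Fin N × Fin N) (Fin N × Fin N) K) = 1 := by
  ext ⟨a, b⟩ ⟨c, d⟩
  simp [pt1, Matrix.one_apply, eq_comm]

/-- The partial transpose `Q` of the permutation operator satisfies `Q² = N Q`. -/
theorem pt1_permP_mul_pt1_permP (K : Type*) [Field K] (N : ℕ) :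
    pt1 (permP K N) * pt1 (permP K N) = (N : K) • pt1 (permP K N) := by
  ext ⟨a, b⟩ ⟨c, d⟩
  rw [Matrix.mul_apply, Fintype.sum_prod_type]
  by_cases hab : a = b <;> by_cases hcd : c = d <;>
    simp [pt1, permP, hab, hcd, eq_comm]

/-- Unnormalized crossing symmetry of the Yang R-matrix in the first factor:
`(R(u)⁻¹)^{t₁} · (R(u + hN))^{t₁} = (1 − h²u⁻²)⁻¹ · id`. -/
theorem yangR_crossing_t1 (K : Type*) [Field K] (N : ℕ) (hN : 1 ≤ N)
    (h u : K) (hu : u ≠ 0) (hu2 : u ^ 2 ≠ h ^ 2) (huN : u + h * N ≠ 0) :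
    pt1 ((yangR K N h u)⁻¹) * pt1 (yangR K N h (u + h * N)) =
      (1 - h ^ 2 / u ^ 2)⁻¹ • (1 : Matrix (Fin N × Fin N) (Fin N × Fin N) K) := by
  have hc : 1 - h ^ 2 / u ^ 2 ≠ 0 := by
    rw [sub_ne_zero, ne_comm, Ne, div_eq_one_iff_eq (pow_ne_zero 2 hu)]
    exact hu2.symm
  have hcoef : h / u - h / (u + h * N) - h / u * (h / (u + h * N)) * N = 0 := by
    field_simp
    ring
  rw [yangR_inv K N hc, yangR, pt1_smul, pt1_add, pt1_sub, pt1_smul, pt1_smul, pt1_one,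
    smul_mul_assoc]
  congr 1
  set Q := pt1 (permP K N) with hQ
  calc (1 + (h / u) • Q) * (1 - (h / (u + h * N)) • Q)
      = 1 + (h / u - h / (u + h * N) - h / u * (h / (u + h * N)) * N) • Q := by
        simp only [add_mul, mul_sub, one_mul, mul_one, smul_mul_smul_comm, hQ,
          pt1_permP_mul_pt1_permP]
        module
    _ = 1 := by rw [hcoef, zero_smul, add_zero]
end

section
/- Let n ≥ 1 be an integer. In the group algebra ℚ[𝔖_n] of the symmetric group, the ordered product over all pairs (i,j) with 1 ≤ i < j ≤ n, taken in lexicographic order (i.e., the nested product ∏_{i=1}^{n-1} ∏_{j=i+1}^{n}, factors multiplied left to right), satisfies: ∏_{1 ≤ i < j ≤ n} ( 1 − (i j)/(j−i) ) = Σ_{s ∈ 𝔖_n} sgn(s)·s, where (i j) denotes the transposition of i and j. (This is the fusion procedure evaluated at the contents of the column diagram with n boxes: the hook product is n! and the resulting idempotent is the antisymmetrizer a^{(n)} = (1/n!) Σ_s sgn(s)·s.) -/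
/-- The list of pairs `(i,j)` with `i < j`, in lexicographic order. -/
def lexPairs (n : ℕ) : List (Fin n × Fin n) :=
  (List.finRange n).flatMap fun i =>
    ((List.finRange n).filter fun j => i < j).map fun j => (i, j)

open Equiv MonoidAlgebra

lemma lexPairs_succ (n : ℕ) :
    lexPairs (n + 1) = (List.finRange n).map (fun j => ((0 : Fin (n + 1)), j.succ)) ++
      (lexPairs n).map (Prod.map Fin.succ Fin.succ) := by
  simp [lexPairs, List.finRange_succ, List.filter_map, List.flatMap_map, List.map_flatMap,
    Function.comp_def]

/-- If `x a * x b * A = -(x b * A)` for all `a < b`, the ordered product of the factors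
`1 - x j / (j + k + 1)` acts on `A` as `1 - (∑ j, x j) / (k + 1)`. -/
lemma prod_one_sub_smul_mul {R : Type*} [Ring R] [Algebra ℚ R] (A : R) {m : ℕ} (k : ℕ)
    (x : Fin m → R) (hx : ∀ a b, a < b → x a * (x b * A) = -(x b * A)) :
    ((List.finRange m).map fun j => 1 - ((j.val : ℚ) + k + 1)⁻¹ • x j).prod * A =
      A - ((k : ℚ) + 1)⁻¹ • ∑ j, x j * A := by
  induction m generalizing k with
  | zero => simp
  | succ m ih =>
    have ih' := ih (k + 1) (fun j => x j.succ) fun a b hab => hx _ _ (Fin.succ_lt_succ_iff.2 hab)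
    have hS : x 0 * ∑ j : Fin m, x j.succ * A = -∑ j : Fin m, x j.succ * A := by
      rw [Finset.mul_sum, ← Finset.sum_neg_distrib]
      exact Finset.sum_congr rfl fun j _ => hx _ _ (Fin.succ_pos j)
    have hprod : ((List.finRange m).map fun j : Fin m =>
        1 - ((j.succ.val : ℚ) + k + 1)⁻¹ • x j.succ).prod * A =
          A - (((k + 1 : ℕ) : ℚ) + 1)⁻¹ • ∑ j : Fin m, x j.succ * A := by
      rw [← ih']
      congr 4
      funext j
      push_cast [Fin.val_succ]
      ring_nf
    rw [List.finRange_succ, List.map_cons, List.prod_cons, List.map_map, mul_assoc,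
      Function.comp_def, hprod, Fin.sum_univ_succ]
    simp only [sub_mul, mul_sub, one_mul, smul_mul_assoc, mul_smul_comm, hS]
    have h1 : (k : ℚ) + 1 ≠ 0 := by positivity
    have h2 : (k : ℚ) + 1 + 1 ≠ 0 := by positivity
    push_cast [Fin.val_zero]
    match_scalars <;> field_simp <;> ring

/-- The embedding of `Perm (Fin n)` in `Perm (Fin (n + 1))` as the stabilizer of `0`. -/
def permFinSuccHom (n : ℕ) : Perm (Fin n) →* Perm (Fin (n + 1)) where
  toFun e := Perm.decomposeFin.symm (0, e)
  map_one' := by simp [Perm.one_def]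
  map_mul' e f := by
    ext i
    cases i using Fin.cases <;> simp

lemma mapDomainAlgHom_of {G H : Type*} [Group G] [Group H] (f : G →* H) (g : G) :
    mapDomainAlgHom ℚ ℚ f (of ℚ G g) = of ℚ H (f g) := by
  simp

lemma permFinSuccHom_swap {n : ℕ} (a b : Fin n) :
    permFinSuccHom n (swap a b) = swap a.succ b.succ := by
  ext i
  cases i using Fin.cases with
  | zero => simp [permFinSuccHom, swap_apply_of_ne_of_ne, (Fin.succ_ne_zero _).symm]
  | succ i =>
    simp only [permFinSuccHom, MonoidHom.coe_mk, OneHom.coe_mk,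
      Perm.decomposeFin_symm_apply_succ, swap_self, refl_apply]
    rw [(Fin.succ_injective n).swap_apply]

lemma decomposeFin_symm_eq_swap_mul {n : ℕ} (p : Fin (n + 1)) (e : Perm (Fin n)) :
    Perm.decomposeFin.symm (p, e) = swap 0 p * permFinSuccHom n e := by
  ext i
  cases i using Fin.cases <;> simp [permFinSuccHom]

/-- The signed sum `∑ sgn(s) s` of all permutations in the rational group algebra. -/
noncomputable def signedSum (n : ℕ) : MonoidAlgebra ℚ (Perm (Fin n)) :=
  ∑ s : Perm (Fin n), ((Perm.sign s : ℤ) : ℚ) • of ℚ (Perm (Fin n)) s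

lemma of_swap_mul_signedSum {n : ℕ} {a b : Fin n} (hab : a ≠ b) :
    of ℚ (Perm (Fin n)) (swap a b) * signedSum n = -signedSum n := by
  rw [signedSum, Finset.mul_sum, ← Finset.sum_neg_distrib]
  refine Fintype.sum_equiv (Equiv.mulLeft (swap a b)) _ _ fun s => ?_
  rw [mul_smul_comm, ← map_mul, coe_mulLeft, Perm.sign_mul, Perm.sign_swap hab]
  simp

lemma signedSum_succ (n : ℕ) :
    signedSum (n + 1) =
      mapDomainAlgHom ℚ ℚ (permFinSuccHom n) (signedSum n) -
        ∑ j : Fin n, of ℚ (Perm (Fin (n + 1))) (swap 0 j.succ) *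
          mapDomainAlgHom ℚ ℚ (permFinSuccHom n) (signedSum n) := by
  have hmap : mapDomainAlgHom ℚ ℚ (permFinSuccHom n) (signedSum n) =
      ∑ s : Perm (Fin n), ((Perm.sign s : ℤ) : ℚ) •
        of ℚ (Perm (Fin (n + 1))) (permFinSuccHom n s) := by
    simp [signedSum]
  rw [hmap, signedSum, ← Perm.decomposeFin.symm.sum_comp, Fintype.sum_prod_type,
    Fin.sum_univ_succ, sub_eq_add_neg, ← Finset.sum_neg_distrib]
  congr 1
  · refine Finset.sum_congr rfl fun s _ => ?_
    rw [Perm.decomposeFin.symm_sign, if_pos rfl, one_mul]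
    rfl
  · refine Finset.sum_congr rfl fun j _ => ?_
    rw [Finset.mul_sum, ← Finset.sum_neg_distrib]
    refine Finset.sum_congr rfl fun s _ => ?_
    rw [Perm.decomposeFin.symm_sign, decomposeFin_symm_eq_swap_mul, mul_smul_comm, ← map_mul,
      if_neg (Fin.succ_ne_zero j)]
    simp

/-- The fusion procedure for the column diagram with `n` boxes: the lexicographically
ordered product `∏_{1 ≤ i < j ≤ n} (1 − (i j)/(j−i))` in `ℚ[𝔖_n]` equals
`Σ_{s ∈ 𝔖_n} sgn(s)·s` (that is, `n!` times the antisymmetrizer). -/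
theorem fusion_column_antisymmetrizer (n : ℕ) (hn : 1 ≤ n) :
    ((lexPairs n).map fun p =>
        (1 : MonoidAlgebra ℚ (Equiv.Perm (Fin n))) -
          ((p.2.val : ℚ) - (p.1.val : ℚ))⁻¹ •
            MonoidAlgebra.of ℚ (Equiv.Perm (Fin n)) (Equiv.swap p.1 p.2)).prod =
      ∑ s : Equiv.Perm (Fin n),
        ((Equiv.Perm.sign s : ℤ) : ℚ) • MonoidAlgebra.of ℚ (Equiv.Perm (Fin n)) s := by
  clear hn
  change _ = signedSum n
  induction n with
  | zero => simp [lexPairs, signedSum, MonoidAlgebra.one_def]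
  | succ n ih =>
    have hrest : (((lexPairs n).map (Prod.map Fin.succ Fin.succ)).map fun p =>
        (1 : MonoidAlgebra ℚ (Perm (Fin (n + 1)))) - ((p.2.val : ℚ) - (p.1.val : ℚ))⁻¹ •
          of ℚ (Perm (Fin (n + 1))) (swap p.1 p.2)).prod =
        mapDomainAlgHom ℚ ℚ (permFinSuccHom n) (signedSum n) := by
      rw [← ih, map_list_prod, List.map_map, List.map_map]
      congr 2
      funext p
      simp only [Function.comp_apply, map_sub, map_one, map_smul, mapDomainAlgHom_of,
        permFinSuccHom_swap, Prod.map_fst, Prod.map_snd, Fin.val_succ, Nat.cast_succ,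
        add_sub_add_right_eq_sub]
    rw [lexPairs_succ, List.map_append, List.prod_append, hrest, signedSum_succ, List.map_map]
    have key := prod_one_sub_smul_mul (mapDomainAlgHom ℚ ℚ (permFinSuccHom n) (signedSum n)) 0
      (fun j : Fin n => of ℚ (Perm (Fin (n + 1))) (swap 0 j.succ)) fun a b hab => ?_
    · simpa [Function.comp_def] using key
    · have hswap : swap 0 a.succ * swap 0 b.succ =
          swap 0 b.succ * permFinSuccHom n (swap a b) := by
        rw [permFinSuccHom_swap, mul_swap_eq_swap_mul (swap 0 b.succ), swap_apply_right,
          swap_apply_of_ne_of_ne (Fin.succ_ne_zero a) (by simpa using hab.ne), swap_comm a.succ 0]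
      rw [← mul_assoc, ← map_mul, hswap, map_mul, mul_assoc, ← mapDomainAlgHom_of,
        ← map_mul,
        of_swap_mul_signedSum hab.ne, map_neg, mul_neg]
end
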